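/- For all s, t ∈ S, the set {F·G : F and G are proper filters in S with s ∈ F, t ∈ G, and d(F) = r(G)} equals the set {H : H is a proper filter in S with s·t ∈ H}. In particular, every proper filter containing s·t can be written as F·G for proper filters F ∋ s and G ∋ t satisfying d(F) = r(G), and every such product F·G is a proper filter containing s·t. -/

import Mathlib

/-- An inverse semigroup with zero: every element `a` has a unique `a⁻¹` with
`a * a⁻¹ * a = a` and `a⁻¹ * a * a⁻¹ = a⁻¹`, and `0` is absorbing. -/
class InvSemigroupWithZero (S : Type*) extends Semigroup S, Zero S, Inv S where
  mul_inv_mul : ∀ a : S, a * a⁻¹ * a = a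
  inv_mul_inv : ∀ a : S, a⁻¹ * a * a⁻¹ = a⁻¹
  inv_unique : ∀ a b : S, a * b * a = a → b * a * b = b → b = a⁻¹
  zero_mul : ∀ a : S, 0 * a = 0
  mul_zero : ∀ a : S, a * 0 = 0

namespace InvSemigroupWithZero

variable {S : Type*} [InvSemigroupWithZero S]

/-- The natural partial order on `S`: `a ≤ b` iff `a = a * a⁻¹ * b`. -/
def sle (a b : S) : Prop := a = a * a⁻¹ * b

/-- `↓s`, the down-set of `s` w.r.t. the natural partial order. -/
def dwn (s : S) : Set S := {t : S | sle t s}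

/-- `↑A`, the up-set generated by `A` w.r.t. the natural partial order. -/
def up (A : Set S) : Set S := {b : S | ∃ a ∈ A, sle a b}

/-- A filter in `S`: a nonempty down-directed up-set. -/
def IsFilt (F : Set S) : Prop :=
  F.Nonempty ∧ up F = F ∧ ∀ a ∈ F, ∀ b ∈ F, ∃ c ∈ F, sle c a ∧ sle c b

/-- A proper filter: a filter not containing `0`. -/
def IsPFilt (F : Set S) : Prop := IsFilt F ∧ (0 : S) ∉ F

/-- An ultrafilter: a proper filter maximal among proper filters. -/
def IsUltra (U : Set S) : Prop :=
  IsPFilt U ∧ ∀ G : Set S, IsPFilt G → U ⊆ G → U = G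

/-- The set `E` of idempotents of `S`. -/
def E (S : Type*) [InvSemigroupWithZero S] : Set S := {e : S | e * e = e}

/-- `F⁻¹ = {a⁻¹ : a ∈ F}`. -/
def finv (F : Set S) : Set S := (fun a : S => a⁻¹) '' F

/-- `F · G = ↑{fg : f ∈ F, g ∈ G}`. -/
def fmul (F G : Set S) : Set S := up (Set.image2 (· * ·) F G)

/-- The source `d(F) := F⁻¹ · F`. -/
def src (F : Set S) : Set S := fmul (finv F) F

/-- The range `r(F) := F · F⁻¹`. -/
def rng (F : Set S) : Set S := fmul F (finv F)

/-- The natural partial order on the idempotents: `e ≤ f` iff `e = e * f`. -/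
def ele (e f : S) : Prop := e = e * f

/-- The down-set of an idempotent `e` inside `E`. -/
def edwn (e : S) : Set S := {f : S | f ∈ E S ∧ ele f e}

/-- The up-set generated by `A` inside `E`. -/
def eup (A : Set S) : Set S := {f : S | f ∈ E S ∧ ∃ a ∈ A, ele a f}

/-- An `E`-filter: a proper filter of the inverse semigroup `E` of idempotents. -/
def IsEFilt (ξ : Set S) : Prop :=
  ξ ⊆ E S ∧ ξ.Nonempty ∧ eup ξ = ξ ∧
    (∀ a ∈ ξ, ∀ b ∈ ξ, ∃ c ∈ ξ, ele c a ∧ ele c b) ∧ (0 : S) ∉ ξ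

/-- An `E`-ultrafilter: an `E`-filter maximal among `E`-filters. -/
def IsEUltra (ξ : Set S) : Prop :=
  IsEFilt ξ ∧ ∀ η : Set S, IsEFilt η → ξ ⊆ η → ξ = η

/-- `β_s(ξ) = {f ∈ E : s·e·s⁻¹ ≤ f for some e ∈ ξ}`. -/
def beta (s : S) (ξ : Set S) : Set S :=
  {f : S | f ∈ E S ∧ ∃ e ∈ ξ, sle (s * e * s⁻¹) f}

/-- The set of proper filters in `S`. -/
abbrev PFilt (S : Type*) [InvSemigroupWithZero S] := {F : Set S // IsPFilt F}

/-- The patch topology on the set of proper filters, generated by the sets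
`F(s;T) = {F : s ∈ F, F ∩ T = ∅}` for `s ∈ S` and finite `T ⊆ ↓s`. -/
instance patchTopology : TopologicalSpace (PFilt S) :=
  TopologicalSpace.generateFrom
    {O : Set (PFilt S) | ∃ (s : S) (T : Set S), T.Finite ∧ T ⊆ dwn s ∧
      O = {F : PFilt S | s ∈ F.1 ∧ F.1 ∩ T = ∅}}

/-- The set of idempotent proper filters in `S`. -/
abbrev IPFilt (S : Type*) [InvSemigroupWithZero S] :=
  {F : Set S // IsPFilt F ∧ (F ∩ E S).Nonempty}

/-- The subspace topology induced by the patch topology on proper filters. -/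
instance : TopologicalSpace (IPFilt S) :=
  TopologicalSpace.induced (fun F => (⟨F.1, F.2.1⟩ : PFilt S)) inferInstance

/-- The set of `E`-filters. -/
abbrev EFilt (S : Type*) [InvSemigroupWithZero S] := {ξ : Set S // IsEFilt ξ}

/-- The patch topology on the set of `E`-filters, generated by the sets
`P(e;X) = {ξ : e ∈ ξ, ξ ∩ X = ∅}` for `e ∈ E` and finite `X ⊆ ↓e ∩ E`. -/
instance : TopologicalSpace (EFilt S) :=
  TopologicalSpace.generateFrom
    {O : Set (EFilt S) | ∃ (e : S) (X : Set S), e ∈ E S ∧ X.Finite ∧ X ⊆ edwn e ∧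
      O = {ξ : EFilt S | e ∈ ξ.1 ∧ ξ.1 ∩ X = ∅}}

/-- The set of ultrafilters in `S`. -/
abbrev UFilt (S : Type*) [InvSemigroupWithZero S] := {U : Set S // IsUltra U}

/-- The subspace topology induced by the patch topology on proper filters. -/
instance : TopologicalSpace (UFilt S) :=
  TopologicalSpace.induced (fun U => (⟨U.1, U.2.1⟩ : PFilt S)) inferInstance

end InvSemigroupWithZero

namespace InvSemigroupWithZero

variable {S : Type*} [InvSemigroupWithZero S] {a b c e f s t h x : S} {F G H : Set S}

/-! ### Inverses and idempotents -/

theorem inv_inv (a : S) : a⁻¹⁻¹ = a :=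
  (inv_unique a⁻¹ a (inv_mul_inv a) (mul_inv_mul a)).symm

theorem inv_eq_self_of_idem (he : e * e = e) : e⁻¹ = e :=
  (inv_unique e e (by rw [he, he]) (by rw [he, he])).symm

theorem mul_inv_idem (a : S) : a * a⁻¹ * (a * a⁻¹) = a * a⁻¹ := by
  rw [← mul_assoc, mul_inv_mul]

theorem inv_mul_idem (a : S) : a⁻¹ * a * (a⁻¹ * a) = a⁻¹ * a := by
  rw [← mul_assoc, inv_mul_inv]

theorem mul_idem (he : e * e = e) (hf : f * f = f) : e * f * (e * f) = e * f := by
  have h₁ := mul_inv_mul (e * f)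
  have h₂ := inv_mul_inv (e * f)
  have hx : f * (e * f)⁻¹ * e = (e * f)⁻¹ := by
    apply inv_unique
    · calc e * f * (f * (e * f)⁻¹ * e) * (e * f)
          = e * (f * f) * (e * f)⁻¹ * (e * e * f) := by simp only [mul_assoc]
        _ = e * f := by rw [he, hf, h₁]
    · calc f * (e * f)⁻¹ * e * (e * f) * (f * (e * f)⁻¹ * e)
          = f * ((e * f)⁻¹ * (e * e * (f * f)) * (e * f)⁻¹) * e := by simp only [mul_assoc]
        _ = f * (e * f)⁻¹ * e := by rw [he, hf, h₂]
  have hxx : (e * f)⁻¹ * (e * f)⁻¹ = (e * f)⁻¹ :=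
    calc (e * f)⁻¹ * (e * f)⁻¹
        = f * (e * f)⁻¹ * e * (f * (e * f)⁻¹ * e) := by rw [hx]
      _ = f * ((e * f)⁻¹ * (e * f) * (e * f)⁻¹) * e := by simp only [mul_assoc]
      _ = (e * f)⁻¹ := by rw [h₂, hx]
  have hself := inv_eq_self_of_idem hxx
  rw [inv_inv] at hself
  rwa [← hself] at hxx

theorem idem_comm (he : e * e = e) (hf : f * f = f) : e * f = f * e := by
  have hef := mul_idem he hf
  have hfe := mul_idem hf he
  have h : f * e = (e * f)⁻¹ := by
    apply inv_unique
    · calc e * f * (f * e) * (e * f) = e * (f * f) * (e * e * f) := by simp only [mul_assoc]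
        _ = e * f := by rw [he, hf, hef]
    · calc f * e * (e * f) * (f * e) = f * (e * e) * (f * f * e) := by simp only [mul_assoc]
        _ = f * e := by rw [he, hf, hfe]
  rw [h, inv_eq_self_of_idem hef]

theorem mul_inv_rev (a b : S) : (a * b)⁻¹ = b⁻¹ * a⁻¹ := by
  have hc := idem_comm (mul_inv_idem b) (inv_mul_idem a)
  refine (inv_unique _ _ ?_ ?_).symm
  · calc a * b * (b⁻¹ * a⁻¹) * (a * b) = a * (b * b⁻¹ * (a⁻¹ * a)) * b := by
          simp only [mul_assoc]
      _ = a * a⁻¹ * a * (b * b⁻¹ * b) := by rw [hc]; simp only [mul_assoc]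
      _ = a * b := by rw [mul_inv_mul, mul_inv_mul]
  · calc b⁻¹ * a⁻¹ * (a * b) * (b⁻¹ * a⁻¹) = b⁻¹ * (a⁻¹ * a * (b * b⁻¹)) * a⁻¹ := by
          simp only [mul_assoc]
      _ = b⁻¹ * b * b⁻¹ * (a⁻¹ * a * a⁻¹) := by rw [← hc]; simp only [mul_assoc]
      _ = b⁻¹ * a⁻¹ := by rw [inv_mul_inv, inv_mul_inv]

theorem conj_idem (a : S) (he : e * e = e) :
    a * e * a⁻¹ * (a * e * a⁻¹) = a * e * a⁻¹ :=
  calc a * e * a⁻¹ * (a * e * a⁻¹) = a * (e * (a⁻¹ * a)) * e * a⁻¹ := by simp only [mul_assoc]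
    _ = a * a⁻¹ * a * (e * e) * a⁻¹ := by
      rw [idem_comm he (inv_mul_idem a)]; simp only [mul_assoc]
    _ = a * e * a⁻¹ := by rw [he, mul_inv_mul]

/-! ### The natural partial order -/

theorem sle_of_eq_idem_mul (he : e * e = e) (h : a = e * b) : sle a b := by
  have hea : e * a = a := by rw [h, ← mul_assoc, he]
  have hae : a * a⁻¹ * e = a * a⁻¹ := by
    rw [← idem_comm he (mul_inv_idem a), ← mul_assoc, hea]
  calc a = a * a⁻¹ * a := (mul_inv_mul a).symm
    _ = a * a⁻¹ * (e * b) := by rw [← h]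
    _ = a * a⁻¹ * b := by rw [← mul_assoc, hae]

theorem sle_iff_exists_idem_mul : sle a b ↔ ∃ e : S, e * e = e ∧ a = e * b :=
  ⟨fun h => ⟨a * a⁻¹, mul_inv_idem a, h⟩, fun ⟨_, he, h⟩ => sle_of_eq_idem_mul he h⟩

theorem sle_of_eq_mul_idem (he : e * e = e) (h : a = b * e) : sle a b := by
  refine sle_of_eq_idem_mul (conj_idem b he) ?_
  calc a = b * b⁻¹ * b * e := by rw [mul_inv_mul, h]
    _ = b * (b⁻¹ * b * e) := by simp only [mul_assoc]
    _ = b * e * b⁻¹ * b := by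
      rw [idem_comm (inv_mul_idem b) he]; simp only [mul_assoc]

theorem sle_iff_exists_mul_idem : sle a b ↔ ∃ e : S, e * e = e ∧ a = b * e := by
  refine ⟨fun h => ?_, fun ⟨_, he, h⟩ => sle_of_eq_mul_idem he h⟩
  obtain ⟨e, he, rfl⟩ := sle_iff_exists_idem_mul.1 h
  refine ⟨b⁻¹ * e * b, ?_, ?_⟩
  · simpa only [inv_inv] using conj_idem b⁻¹ he
  · calc e * b = e * (b * b⁻¹) * b := by rw [mul_assoc, mul_inv_mul]
      _ = b * (b⁻¹ * e * b) := by
        rw [idem_comm he (mul_inv_idem b)]; simp only [mul_assoc]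

theorem sle_refl (a : S) : sle a a := (mul_inv_mul a).symm

theorem sle_trans (hab : sle a b) (hbc : sle b c) : sle a c := by
  obtain ⟨e, he, rfl⟩ := sle_iff_exists_idem_mul.1 hab
  obtain ⟨f, hf, rfl⟩ := sle_iff_exists_idem_mul.1 hbc
  exact sle_of_eq_idem_mul (mul_idem he hf) (mul_assoc e f c).symm

theorem sle_mul_right (h : sle a b) (c : S) : sle (a * c) (b * c) := by
  obtain ⟨e, he, rfl⟩ := sle_iff_exists_idem_mul.1 h
  exact sle_of_eq_idem_mul he (mul_assoc e b c)

theorem sle_mul_left (h : sle a b) (c : S) : sle (c * a) (c * b) := by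
  obtain ⟨e, he, rfl⟩ := sle_iff_exists_mul_idem.1 h
  exact sle_of_eq_mul_idem he (mul_assoc c b e).symm

theorem sle_mul {a' b' : S} (h : sle a b) (h' : sle a' b') : sle (a * a') (b * b') :=
  sle_trans (sle_mul_right h a') (sle_mul_left h' b)

theorem sle_inv (h : sle a b) : sle a⁻¹ b⁻¹ := by
  obtain ⟨e, he, rfl⟩ := sle_iff_exists_idem_mul.1 h
  exact sle_of_eq_mul_idem he (by rw [mul_inv_rev, inv_eq_self_of_idem he])

theorem eq_zero_of_sle_zero (h : sle a 0) : a = 0 := by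
  rw [h, mul_zero]

theorem inv_mul_mul_sle (a b : S) : sle (a⁻¹ * (a * b)) b :=
  sle_of_eq_idem_mul (inv_mul_idem a) (mul_assoc _ _ _).symm

theorem mul_mul_inv_sle (a b : S) : sle (a * b * b⁻¹) a :=
  sle_of_eq_mul_idem (mul_inv_idem b) (mul_assoc _ _ _)

/-! ### Filters -/

theorem subset_up (A : Set S) : A ⊆ up A := fun a ha => ⟨a, ha, sle_refl a⟩

theorem up_up (A : Set S) : up (up A) = up A := by
  refine Set.Subset.antisymm ?_ (subset_up _)
  rintro x ⟨b, ⟨a, ha, hab⟩, hbx⟩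
  exact ⟨a, ha, sle_trans hab hbx⟩

theorem IsFilt.mem_of_sle (hF : IsFilt F) (ha : a ∈ F) (hab : sle a b) : b ∈ F :=
  hF.2.1 ▸ ⟨a, ha, hab⟩

theorem isFilt_up {A : Set S} (hA : A.Nonempty)
    (hdir : ∀ a ∈ A, ∀ b ∈ A, ∃ c ∈ A, sle c a ∧ sle c b) : IsFilt (up A) := by
  refine ⟨hA.mono (subset_up A), up_up A, ?_⟩
  rintro a ⟨a', ha', haa⟩ b ⟨b', hb', hbb⟩
  obtain ⟨c, hc, hca, hcb⟩ := hdir a' ha' b' hb'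
  exact ⟨c, subset_up A hc, sle_trans hca haa, sle_trans hcb hbb⟩

theorem IsFilt.mem_src (hF : IsFilt F) : x ∈ src F ↔ ∃ a ∈ F, sle (a⁻¹ * a) x := by
  constructor
  · rintro ⟨_, ⟨_, ⟨a, ha, rfl⟩, b, hb, rfl⟩, hx⟩
    obtain ⟨c, hc, hca, hcb⟩ := hF.2.2 a ha b hb
    exact ⟨c, hc, sle_trans (sle_mul (sle_inv hca) hcb) hx⟩
  · rintro ⟨a, ha, hx⟩
    exact ⟨_, ⟨_, ⟨a, ha, rfl⟩, a, ha, rfl⟩, hx⟩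

theorem IsFilt.mem_rng (hF : IsFilt F) : x ∈ rng F ↔ ∃ a ∈ F, sle (a * a⁻¹) x := by
  constructor
  · rintro ⟨_, ⟨a, ha, _, ⟨b, hb, rfl⟩, rfl⟩, hx⟩
    obtain ⟨c, hc, hca, hcb⟩ := hF.2.2 a ha b hb
    exact ⟨c, hc, sle_trans (sle_mul hca (sle_inv hcb)) hx⟩
  · rintro ⟨a, ha, hx⟩
    exact ⟨_, ⟨a, ha, _, ⟨a, ha, rfl⟩, rfl⟩, hx⟩

theorem IsFilt.fmul (hF : IsFilt F) (hG : IsFilt G) : IsFilt (fmul F G) := by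
  refine isFilt_up (hF.1.image2 hG.1) ?_
  rintro _ ⟨f₁, hf₁, g₁, hg₁, rfl⟩ _ ⟨f₂, hf₂, g₂, hg₂, rfl⟩
  obtain ⟨f, hf, hff₁, hff₂⟩ := hF.2.2 f₁ hf₁ f₂ hf₂
  obtain ⟨g, hg, hgg₁, hgg₂⟩ := hG.2.2 g₁ hg₁ g₂ hg₂
  exact ⟨f * g, ⟨f, hf, g, hg, rfl⟩, sle_mul hff₁ hgg₁, sle_mul hff₂ hgg₂⟩

theorem IsPFilt.fmul (hF : IsPFilt F) (hG : IsPFilt G) (hFG : src F = rng G) :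
    IsPFilt (fmul F G) := by
  refine ⟨hF.1.fmul hG.1, ?_⟩
  rintro ⟨_, ⟨f, hf, g, hg, rfl⟩, hfg⟩
  have hmem : f⁻¹ * f ∈ rng G := hFG ▸ hF.1.mem_src.2 ⟨f, hf, sle_refl _⟩
  obtain ⟨g', hg', hle⟩ := hG.1.mem_rng.1 hmem
  obtain ⟨k, hk, hkg, hkg'⟩ := hG.1.2.2 g hg g' hg'
  have hkf : sle (k * k⁻¹) (f⁻¹ * f) := sle_trans (sle_mul hkg' (sle_inv hkg')) hle
  have hfk : f * k = 0 := eq_zero_of_sle_zero (sle_trans (sle_mul_left hkg f) hfg)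
  have hk0 : sle k 0 := by
    have := sle_mul_right hkf k
    rwa [mul_inv_mul, mul_assoc, hfk, mul_zero] at this
  exact hG.2 (eq_zero_of_sle_zero hk0 ▸ hk)

/-! ### Factoring a filter containing a product -/

/-- The up-set generated by `H * t⁻¹`. -/
def leftFactor (H : Set S) (t : S) : Set S := up ((fun h : S => h * t⁻¹) '' H)

/-- The up-set generated by `s⁻¹ * H`. -/
def rightFactor (s : S) (H : Set S) : Set S := up ((fun h : S => s⁻¹ * h) '' H)

theorem mul_inv_mul_inv_mul_of_sle (h_le : sle h (s * t)) : h * t⁻¹ * (s⁻¹ * h) = h := by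
  obtain ⟨k, hk, rfl⟩ := sle_iff_exists_mul_idem.1 h_le
  calc s * t * k * t⁻¹ * (s⁻¹ * (s * t * k))
      = s * t * (k * ((s * t)⁻¹ * (s * t))) * k := by
        rw [mul_inv_rev]; simp only [mul_assoc]
    _ = s * t * (s * t)⁻¹ * (s * t) * (k * k) := by
        rw [idem_comm hk (inv_mul_idem _)]; simp only [mul_assoc]
    _ = s * t * k := by rw [mul_inv_mul, hk]

theorem inv_mul_eq_mul_inv_of_sle (h_le : sle h (s * t)) :
    (h * t⁻¹)⁻¹ * (h * t⁻¹) = s⁻¹ * h * (s⁻¹ * h)⁻¹ := by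
  obtain ⟨k, hk, rfl⟩ := sle_iff_exists_mul_idem.1 h_le
  have hu := conj_idem t hk
  have hc := idem_comm hu (inv_mul_idem s)
  have hp : s * t * k * t⁻¹ = s * (t * k * t⁻¹) := by simp only [mul_assoc]
  calc (s * t * k * t⁻¹)⁻¹ * (s * t * k * t⁻¹)
      = t * k * t⁻¹ * (s⁻¹ * s) * (t * k * t⁻¹) := by
        rw [hp, mul_inv_rev s, inv_eq_self_of_idem hu]; simp only [mul_assoc]
    _ = s⁻¹ * s * (t * k * t⁻¹) := by rw [hc, mul_assoc, hu]
    _ = s⁻¹ * s * (t * k * t⁻¹) * (s⁻¹ * s) := by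
        rw [mul_assoc (s⁻¹ * s), hc, ← mul_assoc (s⁻¹ * s) (s⁻¹ * s), inv_mul_idem]
    _ = s⁻¹ * s * (t * (k * k) * t⁻¹) * (s⁻¹ * s) := by rw [hk]
    _ = s⁻¹ * (s * t * k) * (s⁻¹ * (s * t * k))⁻¹ := by
        simp only [mul_inv_rev, inv_inv, inv_eq_self_of_idem hk, mul_assoc]

theorem mem_leftFactor (hst : s * t ∈ H) : s ∈ leftFactor H t :=
  ⟨_, ⟨_, hst, rfl⟩, mul_mul_inv_sle s t⟩

theorem mem_rightFactor (hst : s * t ∈ H) : t ∈ rightFactor s H :=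
  ⟨_, ⟨_, hst, rfl⟩, inv_mul_mul_sle s t⟩

theorem isPFilt_leftFactor (hH : IsPFilt H) (hst : s * t ∈ H) : IsPFilt (leftFactor H t) := by
  refine ⟨isFilt_up (hH.1.1.image _) ?_, ?_⟩
  · rintro _ ⟨a, ha, rfl⟩ _ ⟨b, hb, rfl⟩
    obtain ⟨c, hc, hca, hcb⟩ := hH.1.2.2 a ha b hb
    exact ⟨_, ⟨c, hc, rfl⟩, sle_mul_right hca _, sle_mul_right hcb _⟩
  · rintro ⟨_, ⟨a, ha, rfl⟩, h_le⟩
    obtain ⟨c, hc, hca, hcst⟩ := hH.1.2.2 a ha _ hst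
    have h0 : c * t⁻¹ = 0 := eq_zero_of_sle_zero (sle_trans (sle_mul_right hca _) h_le)
    have hc0 := mul_inv_mul_inv_mul_of_sle hcst
    rw [h0, zero_mul] at hc0
    exact hH.2 (hc0 ▸ hc)

theorem isPFilt_rightFactor (hH : IsPFilt H) (hst : s * t ∈ H) : IsPFilt (rightFactor s H) := by
  refine ⟨isFilt_up (hH.1.1.image _) ?_, ?_⟩
  · rintro _ ⟨a, ha, rfl⟩ _ ⟨b, hb, rfl⟩
    obtain ⟨c, hc, hca, hcb⟩ := hH.1.2.2 a ha b hb
    exact ⟨_, ⟨c, hc, rfl⟩, sle_mul_left hca _, sle_mul_left hcb _⟩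
  · rintro ⟨_, ⟨a, ha, rfl⟩, h_le⟩
    obtain ⟨c, hc, hca, hcst⟩ := hH.1.2.2 a ha _ hst
    have h0 : s⁻¹ * c = 0 := eq_zero_of_sle_zero (sle_trans (sle_mul_left hca _) h_le)
    have hc0 := mul_inv_mul_inv_mul_of_sle hcst
    rw [h0, mul_zero] at hc0
    exact hH.2 (hc0 ▸ hc)

theorem src_leftFactor_eq_rng_rightFactor (hH : IsPFilt H) (hst : s * t ∈ H) :
    src (leftFactor H t) = rng (rightFactor s H) := by
  ext x
  rw [(isPFilt_leftFactor hH hst).1.mem_src, (isPFilt_rightFactor hH hst).1.mem_rng]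
  constructor
  · rintro ⟨a, ⟨_, ⟨h, hh, rfl⟩, ha⟩, hx⟩
    obtain ⟨c, hc, hch, hcst⟩ := hH.1.2.2 h hh _ hst
    have hca := sle_trans (sle_mul_right hch _) ha
    refine ⟨s⁻¹ * c, subset_up _ ⟨c, hc, rfl⟩, ?_⟩
    rw [← inv_mul_eq_mul_inv_of_sle hcst]
    exact sle_trans (sle_mul (sle_inv hca) hca) hx
  · rintro ⟨a, ⟨_, ⟨h, hh, rfl⟩, ha⟩, hx⟩
    obtain ⟨c, hc, hch, hcst⟩ := hH.1.2.2 h hh _ hst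
    have hca := sle_trans (sle_mul_left hch _) ha
    refine ⟨c * t⁻¹, subset_up _ ⟨c, hc, rfl⟩, ?_⟩
    rw [inv_mul_eq_mul_inv_of_sle hcst]
    exact sle_trans (sle_mul hca (sle_inv hca)) hx

theorem fmul_leftFactor_rightFactor (hH : IsPFilt H) (hst : s * t ∈ H) :
    fmul (leftFactor H t) (rightFactor s H) = H := by
  ext x
  constructor
  · rintro ⟨_, ⟨f, ⟨_, ⟨a, ha, rfl⟩, hf⟩, g, ⟨_, ⟨b, hb, rfl⟩, hg⟩, rfl⟩, hx⟩
    obtain ⟨c, hc, hca, hcb⟩ := hH.1.2.2 a ha b hb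
    obtain ⟨d, hd, hdc, hdst⟩ := hH.1.2.2 c hc _ hst
    have hdfg := sle_mul (sle_trans (sle_mul_right (sle_trans hdc hca) _) hf)
      (sle_trans (sle_mul_left (sle_trans hdc hcb) _) hg)
    rw [mul_inv_mul_inv_mul_of_sle hdst] at hdfg
    exact hH.1.mem_of_sle hd (sle_trans hdfg hx)
  · intro hx
    obtain ⟨c, hc, hcx, hcst⟩ := hH.1.2.2 x hx _ hst
    refine ⟨_, ⟨c * t⁻¹, subset_up _ ⟨c, hc, rfl⟩, s⁻¹ * c, subset_up _ ⟨c, hc, rfl⟩, rfl⟩, ?_⟩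
    dsimp only
    rwa [mul_inv_mul_inv_mul_of_sle hcst]

end InvSemigroupWithZero

open InvSemigroupWithZero

/-- For all `s, t ∈ S`,
`{F·G : F, G proper filters, s ∈ F, t ∈ G, d(F) = r(G)}` equals
`{H : H proper filter, s·t ∈ H}`. -/
theorem stmt_8 {S : Type*} [InvSemigroupWithZero S] (s t : S) :
    {H : Set S | ∃ F G : Set S, IsPFilt F ∧ IsPFilt G ∧ s ∈ F ∧ t ∈ G ∧
        src F = rng G ∧ H = fmul F G}
      = {H : Set S | IsPFilt H ∧ s * t ∈ H} := by
  ext H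
  constructor
  · rintro ⟨F, G, hF, hG, hs, ht, hFG, rfl⟩
    exact ⟨hF.fmul hG hFG, s * t, ⟨s, hs, t, ht, rfl⟩, sle_refl _⟩
  · rintro ⟨hH, hst⟩
    exact ⟨_, _, isPFilt_leftFactor hH hst, isPFilt_rightFactor hH hst,
      mem_leftFactor hst, mem_rightFactor hst, src_leftFactor_eq_rng_rightFactor hH hst,
      (fmul_leftFactor_rightFactor hH hst).symm⟩
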